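/- arXiv:2012.05644 — 2 statements merged into one kernel-verified Lean document; each statement's English description precedes it below -/
import Mathlib

section
/- For all graphons W₁, W₂ : [0,1]² → [0,1], the δ₁ distance admits the coupling characterization: δ₁(W₁, W₂) = inf over probability measures π on [0,1] × [0,1] whose two marginals are both the Lebesgue measure on [0,1], of ∫∫ |W₁(x,y) − W₂(x',y')| dπ(x,x') dπ(y,y'). -/
open MeasureTheory unitInterval

noncomputable section

/-- The cut norm of a kernel `U : [0,1]² → ℝ`:
`sup` over measurable `S, T ⊆ [0,1]` of `|∫_{S×T} U|`. -/
def cutNorm (U : I → I → ℝ) : ℝ :=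
  sSup { r : ℝ | ∃ S T : Set I, MeasurableSet S ∧ MeasurableSet T ∧
    r = |∫ p in S ×ˢ T, U p.1 p.2| }

/-- The L¹ norm of a kernel on `[0,1]²`. -/
def l1Norm (U : I → I → ℝ) : ℝ := ∫ p : I × I, |U p.1 p.2|

/-- The L² norm of a kernel on `[0,1]²`. -/
def l2Norm (U : I → I → ℝ) : ℝ := Real.sqrt (∫ p : I × I, (U p.1 p.2) ^ 2)

/-- The cut distance: `inf` over Lebesgue-measure-preserving `φ : [0,1] → [0,1]`
of `‖W₁ - W₂^φ‖_□`. -/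
def cutDist (W₁ W₂ : I → I → ℝ) : ℝ :=
  sInf { r : ℝ | ∃ φ : I → I, MeasurePreserving φ volume volume ∧
    r = cutNorm (fun x y => W₁ x y - W₂ (φ x) (φ y)) }

/-- The δ₁ distance: `inf` over Lebesgue-measure-preserving `φ : [0,1] → [0,1]`
of `‖W₁ - W₂^φ‖_{L¹}`. -/
def delta1 (W₁ W₂ : I → I → ℝ) : ℝ :=
  sInf { r : ℝ | ∃ φ : I → I, MeasurePreserving φ volume volume ∧
    r = l1Norm (fun x y => W₁ x y - W₂ (φ x) (φ y)) }

/-- A graphon: a symmetric measurable function `[0,1]² → [0,1]`. -/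
def IsGraphon (W : I → I → ℝ) : Prop :=
  Measurable (Function.uncurry W) ∧ (∀ x y, W x y = W y x) ∧
    ∀ x y, W x y ∈ Set.Icc (0 : ℝ) 1

open Classical in
/-- The step function associated to a partition `P` of `[0,1]` into `K` measurable
sets and a value matrix `w`. -/
def stepFun {K : ℕ} (P : Fin K → Set I) (w : Fin K → Fin K → ℝ) : I → I → ℝ :=
  fun x y => ∑ k, ∑ k', if x ∈ P k ∧ y ∈ P k' then w k k' else 0

/-- The `n`-th cell of the equitable partition of `[0,1]` into `N` intervals:
`[n/N, (n+1)/N)`, with the last cell closed at `1`. -/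
def eqCell (N : ℕ) (n : Fin N) : Set I :=
  {x : I | ((n : ℕ) : ℝ) / N ≤ (x : ℝ) ∧
    ((x : ℝ) < (((n : ℕ) : ℝ) + 1) / N ∨ (n : ℕ) + 1 = N)}

/-- The step function of a graph with adjacency matrix `A ∈ {0,1}^{N×N}`,
built on the equitable partition of `[0,1]` into `N` intervals. -/
def graphStepFun (N : ℕ) (A : Fin N → Fin N → ℝ) : I → I → ℝ :=
  stepFun (eqCell N) A

/-- The affine map from `[0,1]` onto the `k`-th interval of length `1/n`. -/
def cellParam (n : ℕ) (p : Fin n × I) : I :=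
  Set.projIcc (0 : ℝ) 1 zero_le_one ((p.1 : ℝ) / n + (p.2 : ℝ) / n)

lemma measurable_cellParam (n : ℕ) : Measurable (cellParam n) := by
  have h1 : Measurable fun p : Fin n × I => ((p.1 : ℕ) : ℝ) :=
    (measurable_of_countable fun k : Fin n => ((k : ℕ) : ℝ)).comp measurable_fst
  have h2 : Measurable fun p : Fin n × I => (p.2 : ℝ) :=
    measurable_subtype_coe.comp measurable_snd
  exact continuous_projIcc.measurable.comp ((h1.div_const _).add (h2.div_const _))

lemma coe_cellParam {n : ℕ} (p : Fin n × I) :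
    (cellParam n p : ℝ) = (p.1 : ℝ) / n + (p.2 : ℝ) / n := by
  have hn : (0 : ℝ) < n := by exact_mod_cast p.1.pos
  have hk : ((p.1 : ℕ) : ℝ) + 1 ≤ n := by exact_mod_cast p.1.isLt
  have h0 := p.2.2.1
  have h1 := p.2.2.2
  have hmem : (p.1 : ℝ) / n + (p.2 : ℝ) / n ∈ Set.Icc (0 : ℝ) 1 := by
    rw [← add_div]
    exact ⟨by positivity, by rw [div_le_one hn]; linarith⟩
  rw [cellParam, Set.projIcc_of_mem zero_le_one hmem]

lemma integral_unitInterval_eq (g : ℝ → ℝ) :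
    ∫ x : I, g x = ∫ x in (0 : ℝ)..1, g x := by
  rw [intervalIntegral.integral_of_le zero_le_one, ← integral_Icc_eq_integral_Ioc]
  exact integral_subtype_comap measurableSet_Icc g

lemma map_cellParam {n : ℕ} (hn : 0 < n) :
    ((((n : ENNReal)⁻¹ • Measure.count : Measure (Fin n)).prod
      (volume : Measure I)).map (cellParam n)) = volume := by
  have hn' : (n : ℝ) ≠ 0 := by exact_mod_cast hn.ne'
  have hfin : IsFiniteMeasure ((n : ENNReal)⁻¹ • Measure.count : Measure (Fin n)) :=
    Measure.smul_finite _ (by simp [hn.ne'])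
  apply ext_of_forall_integral_eq_of_IsFiniteMeasure
  intro f
  rw [integral_map (measurable_cellParam n).aemeasurable
    f.continuous.measurable.aestronglyMeasurable]
  set F : ℝ → ℝ := fun x => f (Set.projIcc 0 1 zero_le_one x) with hF
  have hFc : Continuous F := f.continuous.comp continuous_projIcc
  have hint : Integrable (fun p => f (cellParam n p))
      (((n : ENNReal)⁻¹ • Measure.count : Measure (Fin n)).prod (volume : Measure I)) :=
    Integrable.of_bound
      (f.continuous.measurable.comp (measurable_cellParam n)).aestronglyMeasurable ‖f‖
      (Filter.Eventually.of_forall fun p => f.norm_coe_le_norm _)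
  rw [integral_prod _ hint, integral_smul_measure, integral_count]
  have hcell (k : Fin n) : (n : ℝ)⁻¹ • ∫ t : I, f (cellParam n (k, t)) =
      ∫ x in ((k : ℕ) : ℝ) / n..((k : ℕ) + 1 : ℕ) / n, F x := by
    have h := intervalIntegral.inv_smul_integral_comp_add_div (a := 0) (b := 1) F (n : ℝ)
      (((k : ℕ) : ℝ) / n)
    rw [← integral_unitInterval_eq (fun t => F (((k : ℕ) : ℝ) / n + t / n))] at h
    simp only [zero_div, add_zero] at h
    rw [Nat.cast_add_one, add_div]
    exact h
  have hsum := intervalIntegral.sum_integral_adjacent_intervals (f := F) (μ := volume)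
    (a := fun k : ℕ => (k : ℝ) / n) (n := n) (fun k _ => hFc.intervalIntegrable _ _)
  rw [ENNReal.toReal_inv, ENNReal.toReal_natCast, Finset.smul_sum, Finset.sum_congr rfl
    (fun k _ => hcell k), Fin.sum_univ_eq_sum_range
    (fun k : ℕ => ∫ x in (k : ℝ) / n..((k + 1 : ℕ) : ℝ) / n, F x), hsum, div_self hn',
    Nat.cast_zero, zero_div, ← integral_unitInterval_eq]
  simp [hF]

/-- A fine discretization `d` of the identity of `[0,1]` together with a uniform variable `r`
independent of it. -/
lemma exists_discretization {δ : ℝ} (hδ : 0 < δ) :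
    ∃ d r : I → I, Measurable d ∧ Measurable r ∧ (∀ x, dist (d x) x < δ) ∧
      (volume : Measure I).map (fun x => (d x, r x)) =
        ((volume : Measure I).map d).prod volume := by
  obtain ⟨m, hm⟩ := exists_nat_one_div_lt hδ
  set n := m + 1 with hndef
  have hn : 0 < n := m.succ_pos
  have hnR : (0 : ℝ) < n := by exact_mod_cast hn
  have hδn : 1 / (n : ℝ) < δ := by simpa [hndef] using hm
  have hdmem (x : I) : (⌊(n : ℝ) * x⌋ : ℝ) / n ∈ Set.Icc (0 : ℝ) 1 := by
    have h0 := x.2.1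
    refine ⟨div_nonneg ?_ hnR.le, ?_⟩
    · exact_mod_cast Int.floor_nonneg.2 (mul_nonneg hnR.le h0)
    · rw [div_le_one hnR]
      exact (Int.floor_le _).trans (mul_le_of_le_one_right hnR.le x.2.2)
  let d : I → I := fun x => ⟨(⌊(n : ℝ) * x⌋ : ℝ) / n, hdmem x⟩
  let r : I → I := fun x =>
    ⟨Int.fract ((n : ℝ) * x), Int.fract_nonneg _, (Int.fract_lt_one _).le⟩
  have hd : Measurable d := by
    refine Measurable.subtype_mk ?_
    fun_prop
  have hr : Measurable r := by
    refine Measurable.subtype_mk ?_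
    fun_prop
  let c : Fin n → I := fun k => cellParam n (k, 0)
  have hc : Measurable c := measurable_of_countable _
  let u : Measure (Fin n) := (n : ENNReal)⁻¹ • Measure.count
  have hfin : IsFiniteMeasure u := Measure.smul_finite _ (by simp [hn.ne'])
  have hvol : (u.prod (volume : Measure I)).map (cellParam n) = volume := map_cellParam hn
  have hne : ∀ᵐ p ∂(u.prod (volume : Measure I)), p.2 ≠ 1 :=
    Measure.quasiMeasurePreserving_snd.ae (Measure.ae_ne volume (1 : I))
  have hfloor (k : Fin n) (t : I) : (n : ℝ) * cellParam n (k, t) = (k : ℕ) + (t : ℝ) := by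
    rw [coe_cellParam]
    field_simp
  have hae : (fun p => (d (cellParam n p), r (cellParam n p)))
      =ᵐ[u.prod (volume : Measure I)] Prod.map c id := by
    filter_upwards [hne] with p hp
    obtain ⟨k, t⟩ := p
    have ht : (t : ℝ) < 1 := lt_of_le_of_ne t.2.2 fun h => hp (Subtype.ext h)
    have ht0 := t.2.1
    have hfl : ⌊(t : ℝ)⌋ = 0 := Int.floor_eq_zero_iff.2 ⟨ht0, ht⟩
    refine Prod.ext (Subtype.ext ?_) (Subtype.ext ?_)
    · change (⌊(n : ℝ) * cellParam n (k, t)⌋ : ℝ) / n = (cellParam n (k, 0) : ℝ)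
      rw [hfloor, coe_cellParam, Int.floor_natCast_add, hfl]
      simp
    · change Int.fract ((n : ℝ) * cellParam n (k, t)) = (t : ℝ)
      rw [hfloor, Int.fract_natCast_add]
      exact Int.fract_eq_self.2 ⟨ht0, ht⟩
  have hmap : (volume : Measure I).map (fun x => (d x, r x)) = (u.map c).prod volume := by
    conv_lhs => rw [← hvol]
    rw [Measure.map_map (hd.prodMk hr) (measurable_cellParam n)]
    rw [Measure.map_congr (show (fun x => (d x, r x)) ∘ cellParam n =ᵐ[_] _ from hae),
      ← Measure.map_prod_map _ _ hc measurable_id, Measure.map_id]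
  have hmapd : (volume : Measure I).map d = u.map c := by
    have h := congrArg (Measure.map Prod.fst) hmap
    rwa [Measure.map_map measurable_fst (hd.prodMk hr), Measure.map_fst_prod, measure_univ,
      one_smul] at h
  refine ⟨d, r, hd, hr, fun x => ?_, by rw [hmap, hmapd]⟩
  have h1 := Int.floor_le ((n : ℝ) * x)
  have h2 := Int.lt_floor_add_one ((n : ℝ) * x)
  refine lt_of_le_of_lt ?_ hδn
  rw [Subtype.dist_eq, Real.dist_eq, abs_le]
  change -(1 / (n : ℝ)) ≤ (⌊(n : ℝ) * x⌋ : ℝ) / n - x ∧ (⌊(n : ℝ) * x⌋ : ℝ) / n - x ≤ 1 / n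
  have hx : (x : ℝ) = ((n : ℝ) * x) / n := by field_simp
  rw [hx, ← sub_div, ← neg_div, mul_div_cancel₀ _ hnR.ne']
  constructor
  · exact div_le_div_of_nonneg_right (by linarith) hnR.le
  · exact div_le_div_of_nonneg_right (by linarith) hnR.le

/-- A random variable with prescribed joint law with `d` can be realized on `[0,1]` as soon as
there is a uniform variable independent of `d`. -/
lemma exists_map_prodMk_eq {d r : I → I} (hd : Measurable d) (hr : Measurable r)
    (hind : (volume : Measure I).map (fun x => (d x, r x)) =
      ((volume : Measure I).map d).prod volume)
    (ρ : Measure (I × I)) [IsProbabilityMeasure ρ] (hρ : ρ.fst = (volume : Measure I).map d) :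
    ∃ φ : I → I, Measurable φ ∧ (volume : Measure I).map (fun x => (d x, φ x)) = ρ := by
  obtain ⟨f, hf, hfκ⟩ := ProbabilityTheory.Kernel.exists_measurable_map_eq_unitInterval ρ.condKernel
  have hφ : Measurable fun x => f (d x) (r x) := hf.comp (hd.prodMk hr)
  refine ⟨_, hφ, ?_⟩
  have hg : Measurable fun p : I × I => (p.1, f p.1 p.2) := measurable_fst.prodMk hf
  have hprob : IsProbabilityMeasure ((volume : Measure I).map d) :=
    Measure.isProbabilityMeasure_map hd.aemeasurable
  have h : (volume : Measure I).map (fun x => (d x, f (d x) (r x))) =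
      (((volume : Measure I).map d).prod volume).map fun p => (p.1, f p.1 p.2) := by
    rw [← hind, Measure.map_map hg (hd.prodMk hr)]
    rfl
  rw [h]
  conv_rhs => rw [← ρ.disintegrate ρ.condKernel, hρ]
  ext s hs
  rw [Measure.map_apply hg hs, Measure.prod_apply (hg hs), Measure.compProd_apply hs]
  refine lintegral_congr fun a => ?_
  rw [← hfκ a, Measure.map_apply (show Measurable (f a) from hf.comp measurable_prodMk_left)
    (measurable_prodMk_left hs)]
  rfl

lemma integrable_abs_sub {Ω : Type*} [MeasurableSpace Ω] {μ : Measure Ω} [IsFiniteMeasure μ]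
    {f g : Ω → ℝ} (hf : Measurable f) (hg : Measurable g) {a b : ℝ}
    (ha : ∀ x, |f x| ≤ a) (hb : ∀ x, |g x| ≤ b) : Integrable (fun x => |f x - g x|) μ := by
  refine Integrable.of_bound (hf.sub hg).abs.aestronglyMeasurable (a + b)
    (Filter.Eventually.of_forall fun x => ?_)
  rw [Real.norm_eq_abs, abs_abs]
  exact (abs_sub _ _).trans (add_le_add (ha x) (hb x))

lemma integral_abs_sub_le {Ω : Type*} [MeasurableSpace Ω] {μ : Measure Ω} [IsFiniteMeasure μ]
    {f g h : Ω → ℝ} (hf : Measurable f) (hg : Measurable g) (hh : Measurable h) {a b c : ℝ}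
    (ha : ∀ x, |f x| ≤ a) (hb : ∀ x, |g x| ≤ b) (hc : ∀ x, |h x| ≤ c) :
    ∫ x, |f x - h x| ∂μ ≤ ∫ x, |f x - g x| ∂μ + ∫ x, |g x - h x| ∂μ := by
  rw [← integral_add (integrable_abs_sub hf hg ha hb) (integrable_abs_sub hg hh hb hc)]
  exact integral_mono (integrable_abs_sub hf hh ha hc)
    ((integrable_abs_sub hf hg ha hb).add (integrable_abs_sub hg hh hb hc))
    fun x => abs_sub_le _ _ _

lemma IsGraphon.abs_le_one {W : I → I → ℝ} (h : IsGraphon W) (x y : I) : |W x y| ≤ 1 := by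
  obtain ⟨h0, h1⟩ := h.2.2 x y
  exact abs_le.2 ⟨by linarith, h1⟩

/-- A graphon is `L¹`-close to the composition of a suitable bounded function with any
sufficiently fine discretization. -/
lemma IsGraphon.exists_bounded_approx {W : I → I → ℝ} (hW : IsGraphon W) {ε : ℝ} (hε : 0 < ε) :
    ∃ C : I × I → ℝ, ∃ b δ : ℝ, Measurable C ∧ (∀ p, |C p| ≤ b) ∧ 0 < δ ∧
      ∀ d : I → I, Measurable d → (∀ x, dist (d x) x < δ) →
        ∫ p : I × I, |W p.1 p.2 - C (d p.1, d p.2)| ≤ ε := by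
  have hWint : Integrable (fun p : I × I => W p.1 p.2) :=
    Integrable.of_bound hW.1.aestronglyMeasurable 1
      (Filter.Eventually.of_forall fun p => hW.abs_le_one _ _)
  obtain ⟨C, hC, -⟩ := hWint.exists_boundedContinuous_integral_sub_le (half_pos hε)
  have hCb (p : I × I) : |C p| ≤ ‖C‖ := C.norm_coe_le_norm p
  obtain ⟨δ, hδ, hCδ⟩ := Metric.uniformContinuous_iff.1
    (CompactSpace.uniformContinuous_of_continuous C.continuous) (ε / 2) (half_pos hε)
  refine ⟨C, ‖C‖, δ, C.continuous.measurable, hCb, hδ, fun d hd hdδ => ?_⟩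
  have hdd : Measurable fun p : I × I => (d p.1, d p.2) :=
    (hd.comp measurable_fst).prodMk (hd.comp measurable_snd)
  have hCm := C.continuous.measurable
  refine (integral_abs_sub_le hW.1 hCm (hCm.comp hdd) (fun p => hW.abs_le_one _ _) hCb
    (fun p => hCb _)).trans ?_
  have h2 : ∫ p : I × I, |C p - C (d p.1, d p.2)| ≤ ∫ _ : I × I, ε / 2 := by
    refine integral_mono (integrable_abs_sub hCm (hCm.comp hdd) hCb (fun p => hCb _))
      (integrable_const _) fun p => ?_
    refine (hCδ (a := p) (b := (d p.1, d p.2)) ?_).le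
    rw [dist_comm, Prod.dist_eq]
    exact max_lt (hdδ _) (hdδ _)
  rw [integral_const, probReal_univ, one_smul] at h2
  have h1 : ∫ p : I × I, |W p.1 p.2 - C p| ≤ ε / 2 := hC
  calc _ ≤ ε / 2 + ε / 2 := add_le_add h1 h2
    _ = ε := add_halves ε

lemma exists_measurePreserving_l1Norm_le {W₁ W₂ : I → I → ℝ} (h₁ : IsGraphon W₁)
    (h₂ : IsGraphon W₂) (π : Measure (I × I)) [IsProbabilityMeasure π]
    (hfst : π.map Prod.fst = volume) (hsnd : π.map Prod.snd = volume) {ε : ℝ} (hε : 0 < ε) :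
    ∃ φ : I → I, MeasurePreserving φ volume volume ∧
      l1Norm (fun x y => W₁ x y - W₂ (φ x) (φ y)) ≤
        (∫ q : (I × I) × (I × I), |W₁ q.1.1 q.2.1 - W₂ q.1.2 q.2.2| ∂(π.prod π)) + ε := by
  obtain ⟨C, b, δ, hC, hCb, hδ, happ⟩ := h₁.exists_bounded_approx (half_pos hε)
  obtain ⟨d, r, hd, hr, hdδ, hind⟩ := exists_discretization hδ
  have hVW := happ d hd hdδ
  have hdid : Measurable (Prod.map d (id : I → I)) := hd.prodMap measurable_id
  have hρprob : IsProbabilityMeasure (π.map (Prod.map d id)) :=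
    Measure.isProbabilityMeasure_map hdid.aemeasurable
  obtain ⟨φ, hφ, hmap⟩ := exists_map_prodMk_eq hd hr hind (π.map (Prod.map d id)) (by
    rw [Measure.fst, Measure.map_map measurable_fst hdid, ← hfst,
      Measure.map_map hd measurable_fst]
    rfl)
  have hdφ : Measurable fun x => (d x, φ x) := hd.prodMk hφ
  refine ⟨φ, ⟨hφ, ?_⟩, ?_⟩
  · have h := congrArg (Measure.map Prod.snd) hmap
    rw [Measure.map_map measurable_snd hdφ, Measure.map_map measurable_snd hdid] at h
    exact h.trans hsnd
  have hdd : Measurable fun p : I × I => (d p.1, d p.2) :=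
    (hd.comp measurable_fst).prodMk (hd.comp measurable_snd)
  have hφφ : Measurable fun p : I × I => (φ p.1, φ p.2) :=
    (hφ.comp measurable_fst).prodMk (hφ.comp measurable_snd)
  have hV : Measurable fun p : I × I => C (d p.1, d p.2) := hC.comp hdd
  have hq1 : Measurable (Prod.map Prod.fst Prod.fst : (I × I) × (I × I) → I × I) :=
    measurable_fst.prodMap measurable_fst
  have hq2 : Measurable (Prod.map Prod.snd Prod.snd : (I × I) × (I × I) → I × I) :=
    measurable_snd.prodMap measurable_snd
  have htransfer : ∫ p : I × I, |C (d p.1, d p.2) - W₂ (φ p.1) (φ p.2)| =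
      ∫ q : (I × I) × (I × I), |C (d q.1.1, d q.2.1) - W₂ q.1.2 q.2.2| ∂(π.prod π) := by
    set G : (I × I) × (I × I) → ℝ := fun q => |C (q.1.1, q.2.1) - W₂ q.1.2 q.2.2| with hG
    have hGm : Measurable G := ((hC.comp hq1).sub (h₂.1.comp hq2)).abs
    have hl := Measure.map_prod_map (volume : Measure I) (volume : Measure I) hdφ hdφ
    have hr := Measure.map_prod_map π π hdid hdid
    rw [hmap, hr] at hl
    have hi : ∫ q, G q ∂_ = ∫ q, G q ∂_ := congrArg (fun ν => ∫ q, G q ∂ν) hl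
    rw [integral_map (hdid.prodMap hdid).aemeasurable hGm.aestronglyMeasurable,
      integral_map (hdφ.prodMap hdφ).aemeasurable hGm.aestronglyMeasurable] at hi
    exact hi.symm
  have hmarg : ∫ q : (I × I) × (I × I), |C (d q.1.1, d q.2.1) - W₁ q.1.1 q.2.1| ∂(π.prod π) =
      ∫ p : I × I, |W₁ p.1 p.2 - C (d p.1, d p.2)| := by
    have hl := Measure.map_prod_map π π measurable_fst measurable_fst
    rw [hfst] at hl
    have hm : Measurable fun p : I × I => |W₁ p.1 p.2 - C (d p.1, d p.2)| :=
      (h₁.1.sub hV).abs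
    rw [Measure.volume_eq_prod, hl, integral_map hq1.aemeasurable hm.aestronglyMeasurable]
    exact integral_congr_ae (Filter.Eventually.of_forall fun q => abs_sub_comm _ _)
  have hleft := integral_abs_sub_le (μ := (volume : Measure (I × I))) h₁.1 hV (h₂.1.comp hφφ)
    (fun p => h₁.abs_le_one _ _) (fun p => hCb _) (fun p => h₂.abs_le_one _ _)
  have hright := integral_abs_sub_le (μ := π.prod π) (hV.comp hq1) (h₁.1.comp hq1)
    (h₂.1.comp hq2) (fun p => hCb _) (fun p => h₁.abs_le_one _ _) (fun p => h₂.abs_le_one _ _)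
  simp only [Function.comp_apply, Function.uncurry, Prod.map_fst, Prod.map_snd] at hleft hright
  rw [l1Norm]
  linarith

lemma exists_coupling_of_measurePreserving {W₁ W₂ : I → I → ℝ} (h₁ : IsGraphon W₁)
    (h₂ : IsGraphon W₂) {φ : I → I} (hφ : MeasurePreserving φ volume volume) :
    ∃ π : Measure (I × I), IsProbabilityMeasure π ∧
      π.map Prod.fst = volume ∧ π.map Prod.snd = volume ∧
      l1Norm (fun x y => W₁ x y - W₂ (φ x) (φ y)) =
        ∫ q : (I × I) × (I × I), |W₁ q.1.1 q.2.1 - W₂ q.1.2 q.2.2| ∂(π.prod π) := by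
  have hg : Measurable fun x => (x, φ x) := measurable_id.prodMk hφ.measurable
  refine ⟨(volume : Measure I).map fun x => (x, φ x),
    Measure.isProbabilityMeasure_map hg.aemeasurable, ?_, ?_, ?_⟩
  · rw [Measure.map_map measurable_fst hg]
    exact Measure.map_id
  · rw [Measure.map_map measurable_snd hg]
    exact hφ.map_eq
  · have hm : Measurable fun q : (I × I) × (I × I) => |W₁ q.1.1 q.2.1 - W₂ q.1.2 q.2.2| :=
      ((h₁.1.comp (measurable_fst.prodMap measurable_fst)).sub
        (h₂.1.comp (measurable_snd.prodMap measurable_snd))).abs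
    rw [Measure.map_prod_map _ _ hg hg,
      integral_map (hg.prodMap hg).aemeasurable hm.aestronglyMeasurable]
    rfl

/-- coupling characterization of the δ₁ distance. -/
theorem delta1_eq_inf_coupling (W₁ W₂ : I → I → ℝ)
    (h₁ : IsGraphon W₁) (h₂ : IsGraphon W₂) :
    delta1 W₁ W₂ =
      sInf { r : ℝ | ∃ π : Measure (I × I), IsProbabilityMeasure π ∧
        π.map Prod.fst = volume ∧ π.map Prod.snd = volume ∧
        r = ∫ q : (I × I) × (I × I),
          |W₁ q.1.1 q.2.1 - W₂ q.1.2 q.2.2| ∂(π.prod π) } := by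
  refine le_antisymm ?_ ?_
  · refine le_csInf ?_ ?_
    · obtain ⟨π, hπ, hfst, hsnd, h⟩ :=
        exists_coupling_of_measurePreserving h₁ h₂ (MeasurePreserving.id volume)
      exact ⟨_, π, hπ, hfst, hsnd, rfl⟩
    · rintro _ ⟨π, hπ, hfst, hsnd, rfl⟩
      refine le_of_forall_pos_le_add fun ε hε => ?_
      obtain ⟨φ, hφ, hle⟩ := exists_measurePreserving_l1Norm_le h₁ h₂ π hfst hsnd hε
      unfold delta1
      refine le_trans (csInf_le ⟨0, ?_⟩ ⟨φ, hφ, rfl⟩) hle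
      rintro _ ⟨ψ, -, rfl⟩
      exact integral_nonneg fun _ => abs_nonneg _
  · refine csInf_le_csInf ⟨0, ?_⟩ ⟨_, id, MeasurePreserving.id volume, rfl⟩ ?_
    · rintro _ ⟨π, -, -, -, rfl⟩
      exact integral_nonneg fun _ => abs_nonneg _
    · rintro _ ⟨φ, hφ, rfl⟩
      exact exists_coupling_of_measurePreserving h₁ h₂ hφ

end
end

section
/- The cut distance on graphons over [0,1] satisfies the triangle inequality: for all graphons W₁, W₂, W₃ : [0,1]² → [0,1], δ_□(W₁, W₃) ≤ δ_□(W₁, W₂) + δ_□(W₂, W₃). -/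
open MeasureTheory unitInterval

noncomputable section

theorem exists_integral_le_setIntegral {X : Type*} [MeasurableSpace X] {μ m : Measure X}
    (hμ : μ ≤ m) {a : X → ℝ} (ha : Measurable a) (hi : Integrable a m) :
    ∃ A, MeasurableSet A ∧ ∫ x, a x ∂μ ≤ ∫ x in A, a x ∂m := by
  have hA : MeasurableSet {x | 0 ≤ a x} := measurableSet_le measurable_const ha
  refine ⟨{x | 0 ≤ a x}, hA, ?_⟩
  have hiμ : Integrable a μ := hi.mono_measure hμ
  calc ∫ x, a x ∂μ ≤ ∫ x in {x | 0 ≤ a x}, a x ∂μ := by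
        rw [← integral_indicator hA]
        refine integral_mono hiμ (hiμ.indicator hA) fun x => ?_
        by_cases h : 0 ≤ a x
        · simp [h]
        · simpa [h] using (not_le.1 h).le
    _ ≤ ∫ x in {x | 0 ≤ a x}, a x ∂m :=
        integral_mono_measure (Measure.restrict_mono le_rfl hμ)
          (ae_restrict_of_forall_mem hA fun _ hx => hx) hi.integrableOn

theorem exists_integral_prod_le_setIntegral {X Y : Type*} [MeasurableSpace X] [MeasurableSpace Y]
    {μ m : Measure X} {ν n : Measure Y} [IsFiniteMeasure m] [IsFiniteMeasure n]
    [IsFiniteMeasure μ] [IsFiniteMeasure ν] (hμ : μ ≤ m) (hν : ν ≤ n) {u : X × Y → ℝ}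
    (hu : Measurable u) (hi : Integrable u (m.prod n)) :
    ∃ A B, MeasurableSet A ∧ MeasurableSet B ∧
      ∫ p, u p ∂(μ.prod ν) ≤ ∫ p in A ×ˢ B, u p ∂(m.prod n) := by
  have hi₁ : Integrable u (m.prod ν) := hi.mono_measure (Measure.prod_mono le_rfl hν)
  obtain ⟨A, hA, hAle⟩ := exists_integral_le_setIntegral hμ
    (a := fun x => ∫ y, u (x, y) ∂ν)
    hu.stronglyMeasurable.integral_prod_right'.measurable hi₁.integral_prod_left
  have hi₂ : Integrable u ((m.restrict A).prod n) :=
    hi.mono_measure (Measure.prod_mono Measure.restrict_le_self le_rfl)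
  obtain ⟨B, hB, hBle⟩ := exists_integral_le_setIntegral hν
    (a := fun y => ∫ x in A, u (x, y) ∂m)
    hu.stronglyMeasurable.integral_prod_left'.measurable hi₂.integral_prod_right
  refine ⟨A, B, hA, hB, ?_⟩
  calc ∫ p, u p ∂(μ.prod ν) = ∫ x, ∫ y, u (x, y) ∂ν ∂μ :=
        integral_prod _ (hi.mono_measure (Measure.prod_mono hμ hν))
    _ ≤ ∫ x in A, ∫ y, u (x, y) ∂ν ∂m := hAle
    _ = ∫ y, ∫ x in A, u (x, y) ∂m ∂ν :=
        integral_integral_swap (f := fun x y => u (x, y))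
          (hi.mono_measure (Measure.prod_mono Measure.restrict_le_self hν))
    _ ≤ ∫ y in B, ∫ x in A, u (x, y) ∂m ∂n := hBle
    _ = ∫ p in A ×ˢ B, u p ∂(m.prod n) := by
        rw [← Measure.prod_restrict]
        exact (integral_prod_symm _ (hi.mono_measure
          (Measure.prod_mono Measure.restrict_le_self Measure.restrict_le_self))).symm

theorem abs_setIntegral_le_cutNorm {U : I → I → ℝ}
    (hi : Integrable (Function.uncurry U) volume) {S T : Set I}
    (hS : MeasurableSet S) (hT : MeasurableSet T) :
    |∫ p in S ×ˢ T, U p.1 p.2| ≤ cutNorm U := by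
  refine le_csSup ⟨∫ p : I × I, |U p.1 p.2|, ?_⟩ ⟨S, T, hS, hT, rfl⟩
  rintro _ ⟨S, T, -, -, rfl⟩
  exact abs_integral_le_integral_abs.trans
    (setIntegral_le_integral hi.abs (.of_forall fun _ => abs_nonneg _))

theorem cutNorm_nonneg (U : I → I → ℝ) : 0 ≤ cutNorm U := by
  refine Real.sSup_nonneg ?_
  rintro _ ⟨S, T, -, -, rfl⟩
  exact abs_nonneg _

theorem cutNorm_le {U : I → I → ℝ} {C : ℝ}
    (h : ∀ S T, MeasurableSet S → MeasurableSet T → |∫ p in S ×ˢ T, U p.1 p.2| ≤ C) :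
    cutNorm U ≤ C := by
  refine csSup_le ⟨_, ∅, ∅, .empty, .empty, rfl⟩ ?_
  rintro _ ⟨S, T, hS, hT, rfl⟩
  exact h S T hS hT

theorem cutNorm_add_le {U V : I → I → ℝ} (hU : Integrable (Function.uncurry U) volume)
    (hV : Integrable (Function.uncurry V) volume) :
    cutNorm (fun x y => U x y + V x y) ≤ cutNorm U + cutNorm V := by
  refine cutNorm_le fun S T hS hT => ?_
  have h : ∫ p in S ×ˢ T, (U p.1 p.2 + V p.1 p.2) =
      (∫ p in S ×ˢ T, U p.1 p.2) + ∫ p in S ×ˢ T, V p.1 p.2 :=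
    integral_add hU.integrableOn hV.integrableOn
  rw [h]
  exact (abs_add_le _ _).trans (add_le_add (abs_setIntegral_le_cutNorm hU hS hT)
    (abs_setIntegral_le_cutNorm hV hS hT))

theorem cutNorm_comp_le {U : I → I → ℝ} (hU : Measurable (Function.uncurry U))
    (hi : Integrable (Function.uncurry U) volume) {φ : I → I}
    (hφ : MeasurePreserving φ volume volume) :
    cutNorm (fun x y => U (φ x) (φ y)) ≤ cutNorm U := by
  refine cutNorm_le fun S T hS hT => ?_
  have map_le (S : Set I) : (volume.restrict S).map φ ≤ volume :=
    (Measure.map_mono Measure.restrict_le_self hφ.measurable).trans_eq hφ.map_eq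
  have key : ∫ p in S ×ˢ T, U (φ p.1) (φ p.2) = ∫ p, Function.uncurry U p
      ∂(((volume.restrict S).map φ).prod ((volume.restrict T).map φ)) := by
    rw [Measure.map_prod_map _ _ hφ.measurable hφ.measurable,
      integral_map (hφ.measurable.prodMap hφ.measurable).aemeasurable
        hU.aestronglyMeasurable, Measure.prod_restrict]
    rfl
  rw [key, abs_le']
  constructor
  · obtain ⟨A, B, hA, hB, h⟩ :=
      exists_integral_prod_le_setIntegral (map_le S) (map_le T) hU hi
    exact h.trans ((le_abs_self _).trans (abs_setIntegral_le_cutNorm hi hA hB))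
  · obtain ⟨A, B, hA, hB, h⟩ :=
      exists_integral_prod_le_setIntegral (map_le S) (map_le T) hU.neg hi.neg
    simp only [Pi.neg_apply, integral_neg] at h
    exact h.trans ((neg_le_abs _).trans (abs_setIntegral_le_cutNorm hi hA hB))

theorem IsGraphon.integrable {W : I → I → ℝ} (h : IsGraphon W) :
    Integrable (Function.uncurry W) volume :=
  .of_bound h.1.aestronglyMeasurable 1 <| .of_forall fun p => by
    have := h.2.2 p.1 p.2
    simpa [Function.uncurry, abs_of_nonneg this.1] using this.2

theorem IsGraphon.comp {W : I → I → ℝ} (h : IsGraphon W) {φ : I → I} (hφ : Measurable φ) :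
    IsGraphon (fun x y => W (φ x) (φ y)) :=
  ⟨h.1.comp (hφ.prodMap hφ), fun _ _ => h.2.1 _ _, fun _ _ => h.2.2 _ _⟩

theorem cutDist_le {W₁ W₂ : I → I → ℝ} {φ : I → I} (hφ : MeasurePreserving φ volume volume) :
    cutDist W₁ W₂ ≤ cutNorm (fun x y => W₁ x y - W₂ (φ x) (φ y)) := by
  refine csInf_le ⟨0, ?_⟩ ⟨φ, hφ, rfl⟩
  rintro _ ⟨φ, -, rfl⟩
  exact cutNorm_nonneg _

theorem le_cutDist {W₁ W₂ : I → I → ℝ} {C : ℝ}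
    (h : ∀ φ : I → I, MeasurePreserving φ volume volume →
      C ≤ cutNorm (fun x y => W₁ x y - W₂ (φ x) (φ y))) :
    C ≤ cutDist W₁ W₂ := by
  refine le_csInf ⟨_, id, .id _, rfl⟩ ?_
  rintro _ ⟨φ, hφ, rfl⟩
  exact h φ hφ

/-- the cut distance satisfies the triangle inequality. -/
theorem cutDist_triangle (W₁ W₂ W₃ : I → I → ℝ)
    (h₁ : IsGraphon W₁) (h₂ : IsGraphon W₂) (h₃ : IsGraphon W₃) :
    cutDist W₁ W₃ ≤ cutDist W₁ W₂ + cutDist W₂ W₃ := by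
  rw [← sub_le_iff_le_add]
  refine le_cutDist fun φ hφ => ?_
  rw [sub_le_comm]
  refine le_cutDist fun ψ hψ => ?_
  rw [sub_le_iff_le_add']
  have h₃ψ := h₃.comp hψ.measurable
  have hi : Integrable (Function.uncurry fun x y => W₂ x y - W₃ (ψ x) (ψ y)) volume :=
    h₂.integrable.sub h₃ψ.integrable
  have h₂φ := h₂.comp hφ.measurable
  calc cutDist W₁ W₃ ≤ cutNorm (fun x y => W₁ x y - W₃ (ψ (φ x)) (ψ (φ y))) :=
        cutDist_le (hψ.comp hφ)
    _ = cutNorm (fun x y => (W₁ x y - W₂ (φ x) (φ y)) +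
          (W₂ (φ x) (φ y) - W₃ (ψ (φ x)) (ψ (φ y)))) := by simp only [sub_add_sub_cancel]
    _ ≤ cutNorm (fun x y => W₁ x y - W₂ (φ x) (φ y)) +
          cutNorm (fun x y => W₂ (φ x) (φ y) - W₃ (ψ (φ x)) (ψ (φ y))) :=
        cutNorm_add_le (h₁.integrable.sub h₂φ.integrable)
          (h₂φ.integrable.sub (h₃ψ.comp hφ.measurable).integrable)
    _ ≤ _ := by
        gcongr
        exact cutNorm_comp_le (U := fun x y => W₂ x y - W₃ (ψ x) (ψ y))
          (h₂.1.sub h₃ψ.1) hi hφ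

end
end
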